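/- There exist β₀ > 0 and L > 0 such that for all β ≤ β₀, all h ≥ 0 and all N ≥ 1, |ν(σ̄₁(R_{1,3} − q))| ≤ L/N, where σ̄₁ = σ₁¹ − σ₁² and σ¹, σ², σ³ are three independent replicas. -/

import Mathlib

open MeasureTheory ProbabilityTheory Finset

noncomputable section

/-- A spin configuration on `N` sites. -/
abbrev Cfg (N : ℕ) := Fin N → Bool

/-- The spin value `±1` of a Boolean. -/
def spin (b : Bool) : ℝ := if b then 1 else -1

/-- Minus the SK Hamiltonian. -/
def negH (N : ℕ) (β h : ℝ) (g : Fin N → Fin N → ℝ) (σ : Cfg N) : ℝ :=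
  (β / Real.sqrt N) *
      ∑ i : Fin N, ∑ j : Fin N, (if i < j then g i j * spin (σ i) * spin (σ j) else 0) +
    h * ∑ i : Fin N, spin (σ i)

/-- Gibbs average `⟨f⟩` of a function of `ι`-indexed replicas. -/
def gibbs (N : ℕ) (β h : ℝ) (g : Fin N → Fin N → ℝ) {ι : Type} [DecidableEq ι] [Fintype ι]
    (f : (ι → Cfg N) → ℝ) : ℝ :=
  (∑ σs : ι → Cfg N, f σs * ∏ l, Real.exp (negH N β h g (σs l))) /
    (∑ σ : Cfg N, Real.exp (negH N β h g σ)) ^ (Fintype.card ι)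

/-- The law of the disorder: i.i.d. standard Gaussians. -/
def gaussN (N : ℕ) : Measure (Fin N → Fin N → ℝ) :=
  Measure.pi fun _ => Measure.pi fun _ => gaussianReal 0 1

/-- `ν(f) = E⟨f⟩`. -/
def nu (N : ℕ) (β h : ℝ) {ι : Type} [DecidableEq ι] [Fintype ι]
    (f : (ι → Cfg N) → ℝ) : ℝ :=
  ∫ g, gibbs N β h g f ∂ gaussN N

/-- `S_l = Σ_i t_i (σ_i^{1(l)} - σ_i^{2(l)})`, replica pairs indexed by `Fin m × Fin 2`. -/
def Sbar (N m : ℕ) (t : Fin N → ℝ) (σs : Fin m × Fin 2 → Cfg N) (l : Fin m) : ℝ :=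
  ∑ i, t i * (spin (σs (l, 0) i) - spin (σs (l, 1) i))

/-- `a(k)`: the `k`-th moment of a standard Gaussian. -/
def gaussMoment (k : ℕ) : ℝ := ∫ x, x ^ k ∂ (gaussianReal 0 1 : Measure ℝ)

/-- The overlap `R_{l,l'}` of two configurations. -/
def overlap (N : ℕ) (σ τ : Cfg N) : ℝ := (∑ i, spin (σ i) * spin (τ i)) / N

theorem deriv_two_of_max {f f' : ℝ → ℝ} {a : ℝ} (hmax : ∀ s, f s ≤ f 0)
    (hf : ∀ s, HasDerivAt f (f' s) s) (hf' : HasDerivAt f' a 0) : f' 0 = 0 ∧ a ≤ 0 := by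
  have h0 : f' 0 = 0 := by
    have : IsLocalMax f 0 := Filter.Eventually.of_forall hmax
    exact this.hasDerivAt_eq_zero (hf 0)
  refine ⟨h0, ?_⟩
  by_contra! ha
  have hd : deriv f = f' := funext fun s => (hf s).deriv
  have hmin : IsLocalMin f 0 := by
    apply isLocalMin_of_deriv_deriv_pos
    · rw [hd, hf'.deriv]; exact ha
    · rw [hd, h0]
    · exact (hf 0).continuousAt
  have hc : f =ᶠ[nhds 0] fun _ => f 0 := by
    filter_upwards [hmin] with s hs
    exact le_antisymm (hmax s) hs
  have h1 : deriv f =ᶠ[nhds 0] fun _ => 0 := by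
    have := hc.deriv
    simpa using this
  have h2 := h1.deriv_eq
  rw [hd, hf'.deriv] at h2
  simp at h2
  linarith

/-- Average of `F` under the (unnormalised) weights `w`. -/
def avg {Ω : Type*} [Fintype Ω] (w F : Ω → ℝ) : ℝ :=
  (∑ ω, F ω * w ω) / ∑ ω, w ω

/-- Variance of `X` under the weights `w`. -/
def wvar {Ω : Type*} [Fintype Ω] (w X : Ω → ℝ) : ℝ :=
  avg w (fun ω => X ω ^ 2) - avg w X ^ 2

section avg
variable {Ω : Type*} [Fintype Ω]

theorem hasDerivAt_avg {w : ℝ → Ω → ℝ} {G : Ω → ℝ} {s : ℝ}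
    (hw : ∀ ω, HasDerivAt (fun r => w r ω) (w s ω * G ω) s) (hZ : ∑ ω, w s ω ≠ 0) (F : Ω → ℝ) :
    HasDerivAt (fun r => avg (w r) F)
      (avg (w s) (fun ω => F ω * G ω) - avg (w s) F * avg (w s) G) s := by
  have h1 : HasDerivAt (fun r => ∑ ω, F ω * w r ω) (∑ ω, F ω * (w s ω * G ω)) s :=
    HasDerivAt.fun_sum fun ω _ => (hw ω).const_mul (F ω)
  have h2 : HasDerivAt (fun r => ∑ ω, w r ω) (∑ ω, w s ω * G ω) s :=
    HasDerivAt.fun_sum fun ω _ => hw ω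
  refine (h1.fun_div h2 hZ).congr_deriv ?_
  have e1 : ∑ ω, F ω * G ω * w s ω = ∑ ω, F ω * (w s ω * G ω) :=
    sum_congr rfl fun ω _ => by ring
  have e2 : ∑ ω, G ω * w s ω = ∑ ω, w s ω * G ω := sum_congr rfl fun ω _ => by ring
  simp only [avg, e1, e2]
  field_simp

theorem hasDerivAt_wvar {w : ℝ → Ω → ℝ} {G : Ω → ℝ} {s : ℝ}
    (hw : ∀ ω, HasDerivAt (fun r => w r ω) (w s ω * G ω) s) (hZ : ∑ ω, w s ω ≠ 0) (X : Ω → ℝ) :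
    HasDerivAt (fun r => wvar (w r) X)
      (avg (w s) (fun ω => X ω ^ 2 * G ω) - avg (w s) (fun ω => X ω ^ 2) * avg (w s) G
        - 2 * avg (w s) X * (avg (w s) (fun ω => X ω * G ω) - avg (w s) X * avg (w s) G)) s := by
  have h1 := hasDerivAt_avg hw hZ (fun ω => X ω ^ 2)
  have h2 := (hasDerivAt_avg hw hZ X).fun_pow 2
  refine (h1.fun_sub h2).congr_deriv ?_
  push_cast
  ring

theorem avg_add (w F G : Ω → ℝ) : avg w (fun ω => F ω + G ω) = avg w F + avg w G := by
  simp only [avg, add_mul, sum_add_distrib, add_div]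

theorem avg_sub (w F G : Ω → ℝ) : avg w (fun ω => F ω - G ω) = avg w F - avg w G := by
  simp only [avg, sub_mul, sum_sub_distrib, sub_div]

theorem avg_const_mul (w : Ω → ℝ) (c : ℝ) (F : Ω → ℝ) :
    avg w (fun ω => c * F ω) = c * avg w F := by
  simp only [avg, mul_assoc, ← mul_sum, mul_div_assoc]

theorem avg_sum {κ : Type*} (s : Finset κ) (w : Ω → ℝ) (F : κ → Ω → ℝ) :
    avg w (fun ω => ∑ k ∈ s, F k ω) = ∑ k ∈ s, avg w (F k) := by
  simp only [avg, sum_mul]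
  rw [sum_comm, sum_div]

theorem avg_const {w : Ω → ℝ} (hZ : ∑ ω, w ω ≠ 0) (c : ℝ) : avg w (fun _ => c) = c := by
  simp only [avg, ← mul_sum]
  field_simp

theorem avg_smul {c : ℝ} (hc : c ≠ 0) (w F : Ω → ℝ) : avg (fun ω => c * w ω) F = avg w F := by
  have : ∀ ω, F ω * (c * w ω) = c * (F ω * w ω) := fun ω => by ring
  simp only [avg, this, ← mul_sum]
  exact mul_div_mul_left _ _ hc

theorem wvar_smul {c : ℝ} (hc : c ≠ 0) (w X : Ω → ℝ) : wvar (fun ω => c * w ω) X = wvar w X := by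
  simp only [wvar, avg_smul hc]

theorem avg_mono {w F G : Ω → ℝ} (hw : ∀ ω, 0 ≤ w ω) (h : ∀ ω, F ω ≤ G ω) :
    avg w F ≤ avg w G := by
  unfold avg
  have : 0 ≤ ∑ ω, w ω := sum_nonneg fun ω _ => hw ω
  gcongr with ω _
  · exact hw ω
  · exact h ω

theorem avg_sub_sq {w : Ω → ℝ} (hZ : ∑ ω, w ω ≠ 0) (X : Ω → ℝ) (c : ℝ) :
    avg w (fun ω => (X ω - c) ^ 2) = wvar w X + (avg w X - c) ^ 2 := by
  have : (fun ω => (X ω - c) ^ 2) = fun ω => X ω ^ 2 + ((-2 * c) * X ω + c ^ 2) := by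
    funext ω; ring
  rw [this, avg_add, avg_add, avg_const_mul, avg_const hZ, wvar]
  ring

theorem wvar_nonneg {w : Ω → ℝ} (hw : ∀ ω, 0 ≤ w ω) (hZ : ∑ ω, w ω ≠ 0) (X : Ω → ℝ) :
    0 ≤ wvar w X := by
  have h := avg_sub_sq hZ X (avg w X)
  have h2 := avg_mono (w := w) (F := fun _ => 0) (G := fun ω => (X ω - avg w X) ^ 2) hw
    (fun ω => sq_nonneg _)
  rw [avg_const hZ, h] at h2
  simpa using h2

/-- Covariance under the weights `w`. -/
def wcov (w X Y : Ω → ℝ) : ℝ := avg w (fun ω => X ω * Y ω) - avg w X * avg w Y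

theorem wcov_sum_right {κ : Type*} (s : Finset κ) (w X : Ω → ℝ) (c : κ → ℝ) (Y : κ → Ω → ℝ) :
    wcov w X (fun ω => ∑ k ∈ s, c k * Y k ω) = ∑ k ∈ s, c k * wcov w X (Y k) := by
  have : (fun ω => X ω * ∑ k ∈ s, c k * Y k ω) = fun ω => ∑ k ∈ s, c k * (X ω * Y k ω) := by
    funext ω
    rw [mul_sum]
    exact sum_congr rfl fun k _ => by ring
  simp only [wcov]
  rw [this]
  simp only [avg_sum, avg_const_mul, mul_sub, sum_sub_distrib, mul_sum]
  congr 1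
  exact sum_congr rfl fun k _ => by ring

theorem wvar_mul_sub (w X Y : Ω → ℝ) (s : ℝ) :
    wvar w (fun ω => s * X ω - Y ω) = s ^ 2 * wvar w X - 2 * s * wcov w X Y + wvar w Y := by
  have : (fun ω => (s * X ω - Y ω) ^ 2) =
      fun ω => s ^ 2 * X ω ^ 2 + ((-2 * s) * (X ω * Y ω) + Y ω ^ 2) := by funext ω; ring
  simp only [wvar, wcov, this, avg_add, avg_sub, avg_const_mul]
  ring

/-- The heat-flow inequality for the variance: if tilting the weights by any `exp (s * Y k)` does
not increase the variance of `X`, then its derivative along `exp (t / 2 * ∑ k, Y k ^ 2)` is at most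
`∑ k, Cov(X, Y k) ^ 2`. -/
theorem wvar_deriv_le {κ : Type*} [Fintype κ] {w : Ω → ℝ} (hw : ∀ ω, 0 ≤ w ω)
    (hZ : 0 < ∑ ω, w ω) (X : Ω → ℝ) (Y : κ → Ω → ℝ)
    (hmax : ∀ k s, wvar (fun ω => w ω * Real.exp (s * Y k ω)) X ≤ wvar w X) :
    avg w (fun ω => X ω ^ 2 * ((1 / 2) * ∑ k, Y k ω ^ 2))
      - avg w (fun ω => X ω ^ 2) * avg w (fun ω => (1 / 2) * ∑ k, Y k ω ^ 2)
      - 2 * avg w X * (avg w (fun ω => X ω * ((1 / 2) * ∑ k, Y k ω ^ 2))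
        - avg w X * avg w (fun ω => (1 / 2) * ∑ k, Y k ω ^ 2)) ≤ ∑ k, wcov w X (Y k) ^ 2 := by
  have key : ∀ k, (1 / 2) * (avg w (fun ω => X ω ^ 2 * Y k ω ^ 2)
      - avg w (fun ω => X ω ^ 2) * avg w (fun ω => Y k ω ^ 2)
      - 2 * avg w X * (avg w (fun ω => X ω * Y k ω ^ 2)
        - avg w X * avg w (fun ω => Y k ω ^ 2))) ≤ wcov w X (Y k) ^ 2 := by
    intro k
    set W : ℝ → Ω → ℝ := fun s ω => w ω * Real.exp (s * Y k ω) with hW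
    have hW0 : W 0 = w := by funext ω; simp [hW]
    have hWd : ∀ s ω, HasDerivAt (fun r => W r ω) (W s ω * Y k ω) s := by
      intro s ω
      have := (((hasDerivAt_id s).mul_const (Y k ω)).exp).const_mul (w ω)
      simpa [hW, mul_assoc] using this
    have hWZ : ∀ s, ∑ ω, W s ω ≠ 0 := by
      intro s hs
      have h0 : ∀ ω ∈ univ, 0 ≤ W s ω := fun ω _ => mul_nonneg (hw ω) (Real.exp_pos _).le
      rw [sum_eq_zero_iff_of_nonneg h0] at hs
      apply hZ.ne'
      refine sum_eq_zero fun ω hω => ?_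
      simpa [hW, Real.exp_ne_zero] using hs ω hω
    have hφ := fun s => hasDerivAt_wvar (hWd s) (hWZ s) X
    have D := hasDerivAt_avg (hWd 0) (hWZ 0)
    have hφ' := ((D (fun ω => X ω ^ 2 * Y k ω)).fun_sub
      ((D (fun ω => X ω ^ 2)).fun_mul (D (Y k)))).fun_sub
      (((D X).const_mul 2).fun_mul ((D (fun ω => X ω * Y k ω)).fun_sub ((D X).fun_mul (D (Y k)))))
    obtain ⟨h1, h2⟩ := deriv_two_of_max (f := fun s => wvar (W s) X)
      (by intro s; rw [hW0]; exact hmax k s) hφ hφ'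
    simp only [hW0] at h1 h2
    have e1 : (fun ω => X ω ^ 2 * Y k ω * Y k ω) = fun ω => X ω ^ 2 * Y k ω ^ 2 := by
      funext ω; ring
    have e2 : (fun ω => X ω * Y k ω * Y k ω) = fun ω => X ω * Y k ω ^ 2 := by funext ω; ring
    have e3 : (fun ω => Y k ω * Y k ω) = fun ω => Y k ω ^ 2 := by funext ω; ring
    rw [e1, e2, e3] at h2
    simp only [wcov]
    linear_combination (1 / 2) * h2 + avg w (Y k) * h1
  refine le_trans (le_of_eq ?_) (sum_le_sum fun k _ => key k)
  have e : ∀ F : Ω → ℝ, avg w (fun ω => F ω * ((1 / 2) * ∑ k, Y k ω ^ 2)) =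
      (1 / 2) * ∑ k, avg w (fun ω => F ω * Y k ω ^ 2) := by
    intro F
    rw [← avg_sum, ← avg_const_mul]
    congr 1; funext ω; rw [← mul_sum]; ring
  have e' : avg w (fun ω => ((1 / 2) * ∑ k, Y k ω ^ 2)) =
      (1 / 2) * ∑ k, avg w (fun ω => Y k ω ^ 2) := by
    rw [← avg_sum, ← avg_const_mul]
  rw [e, e, e', ← mul_sum]
  simp only [sum_sub_distrib, mul_sub, mul_sum]
  congr 1
  · congr 1
    exact sum_congr rfl fun k _ => by ring
  · congr 1
    · exact sum_congr rfl fun k _ => by ring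
    · exact sum_congr rfl fun k _ => by ring

end avg

section product

variable {n : ℕ} {κ : Type*} [Fintype κ]

/-- The linear functional `∑ i, v i * σ i` of the spins. -/
def lin (v : Fin n → ℝ) (σ : Cfg n) : ℝ := ∑ i, v i * spin (σ i)

/-- Weights of an Ising model with interaction `t * Bᵀ B` and product reference measure `p`. -/
def isingW (B : κ → Fin n → ℝ) (t : ℝ) (p : Fin n → Bool → ℝ) (σ : Cfg n) : ℝ :=
  Real.exp (t * ((1 / 2) * ∑ k, lin (B k) σ ^ 2)) * ∏ i, p i (σ i)

/-- Families of probability vectors on `Bool`. -/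
def probs (n : ℕ) : Set (Fin n → Bool → ℝ) := Set.univ.pi fun _ => stdSimplex ℝ Bool

theorem spin_sq (b : Bool) : spin b ^ 2 = 1 := by cases b <;> simp [spin]

theorem probs_nonneg {p : Fin n → Bool → ℝ} (hp : p ∈ probs n) (i : Fin n) (b : Bool) :
    0 ≤ p i b := (hp i trivial).1 b

theorem probs_sum {p : Fin n → Bool → ℝ} (hp : p ∈ probs n) (i : Fin n) :
    ∑ b, p i b = 1 := (hp i trivial).2

theorem probs_exists_pos {p : Fin n → Bool → ℝ} (hp : p ∈ probs n) (i : Fin n) :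
    ∃ b, 0 < p i b := by
  by_contra! h
  have h1 := probs_sum hp i
  have : ∑ b, p i b ≤ 0 := sum_nonpos fun b _ => h b
  linarith

theorem isingW_nonneg (B : κ → Fin n → ℝ) (t : ℝ) {p : Fin n → Bool → ℝ} (hp : p ∈ probs n)
    (σ : Cfg n) : 0 ≤ isingW B t p σ :=
  mul_nonneg (Real.exp_pos _).le (prod_nonneg fun i _ => probs_nonneg hp i _)

theorem isingW_sum_pos (B : κ → Fin n → ℝ) (t : ℝ) {p : Fin n → Bool → ℝ} (hp : p ∈ probs n) :
    0 < ∑ σ, isingW B t p σ := by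
  choose b hb using probs_exists_pos hp
  refine sum_pos' (fun σ _ => isingW_nonneg B t hp σ) ⟨b, mem_univ _, ?_⟩
  exact mul_pos (Real.exp_pos _) (prod_pos fun i _ => hb i)

theorem isingW_tilt (B : κ → Fin n → ℝ) (t : ℝ) {p : Fin n → Bool → ℝ} (hp : p ∈ probs n)
    (u : Fin n → ℝ) (s : ℝ) : ∃ p' ∈ probs n, ∃ c : ℝ, c ≠ 0 ∧
      (fun σ => isingW B t p σ * Real.exp (s * lin u σ)) = fun σ => c * isingW B t p' σ := by
  set m : Fin n → ℝ := fun i => ∑ b, p i b * Real.exp (s * (u i * spin b)) with hm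
  have hnn : ∀ i b, 0 ≤ p i b * Real.exp (s * (u i * spin b)) := fun i b =>
    mul_nonneg (probs_nonneg hp i b) (Real.exp_pos _).le
  have hpos : ∀ i, 0 < m i := by
    intro i
    obtain ⟨b, hb⟩ := probs_exists_pos hp i
    exact sum_pos' (fun b _ => hnn i b) ⟨b, mem_univ _, mul_pos hb (Real.exp_pos _)⟩
  refine ⟨fun i b => p i b * Real.exp (s * (u i * spin b)) / m i, ?_, ∏ i, m i, ?_, ?_⟩
  · intro i _
    refine ⟨fun b => div_nonneg (hnn i b) (hpos i).le, ?_⟩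
    rw [← sum_div]
    exact div_self (hpos i).ne'
  · exact prod_ne_zero_iff.2 fun i _ => (hpos i).ne'
  · funext σ
    have h1 : (∏ i, p i (σ i) * Real.exp (s * (u i * spin (σ i))) / m i) =
        (∏ i, p i (σ i)) * Real.exp (s * lin u σ) / ∏ i, m i := by
      rw [prod_div_distrib, prod_mul_distrib, ← Real.exp_sum, lin, mul_sum]
    have h2 : (∏ i, m i) ≠ 0 := prod_ne_zero_iff.2 fun i _ => (hpos i).ne'
    simp only [isingW, h1]
    field_simp

theorem continuous_isingW (B : κ → Fin n → ℝ) (σ : Cfg n) :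
    Continuous fun x : ℝ × (Fin n → Bool → ℝ) => isingW B x.1 x.2 σ := by
  unfold isingW
  fun_prop

theorem continuousOn_wvar_isingW (B : κ → Fin n → ℝ) :
    ContinuousOn (fun x : ℝ × (Fin n → Bool → ℝ) × (Fin n → ℝ) =>
      wvar (isingW B x.1 x.2.1) (lin x.2.2)) {x | x.2.1 ∈ probs n} := by
  have hW : ∀ σ, Continuous fun x : ℝ × (Fin n → Bool → ℝ) × (Fin n → ℝ) =>
      isingW B x.1 x.2.1 σ := fun σ =>
    (continuous_isingW B σ).comp (continuous_fst.prodMk (continuous_fst.comp continuous_snd))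
  have hl : ∀ σ : Cfg n, Continuous fun x : ℝ × (Fin n → Bool → ℝ) × (Fin n → ℝ) =>
      lin x.2.2 σ := fun σ => by unfold lin; fun_prop
  have hZ : ∀ x ∈ {x : ℝ × (Fin n → Bool → ℝ) × (Fin n → ℝ) | x.2.1 ∈ probs n},
      ∑ σ, isingW B x.1 x.2.1 σ ≠ 0 := fun x hx => (isingW_sum_pos B x.1 hx).ne'
  unfold wvar avg
  refine ContinuousOn.sub (ContinuousOn.div ?_ ?_ hZ) ((ContinuousOn.div ?_ ?_ hZ).pow 2) <;>
  · refine Continuous.continuousOn ?_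
    fun_prop

theorem wvar_isingW_zero_le (B : κ → Fin n → ℝ) {p : Fin n → Bool → ℝ} (hp : p ∈ probs n)
    (v : Fin n → ℝ) : wvar (isingW B 0 p) (lin v) ≤ ∑ i, v i ^ 2 := by
  have hw : isingW B 0 p = fun σ => ∏ i, p i (σ i) := by funext σ; simp [isingW]
  have hZ1 : ∑ σ, isingW B 0 p σ = 1 := by
    rw [hw, ← Fintype.prod_sum]
    exact prod_eq_one fun i _ => probs_sum hp i
  have hZ : ∑ σ, isingW B 0 p σ ≠ 0 := by rw [hZ1]; exact one_ne_zero
  set m : Fin n → ℝ := fun i => ∑ b, p i b * spin b with hm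
  have hcov : ∀ i j, i ≠ j →
      avg (isingW B 0 p) (fun σ => (spin (σ i) - m i) * (spin (σ j) - m j)) = 0 := by
    intro i j hij
    unfold avg
    rw [hZ1, div_one, hw]
    have : ∀ σ : Cfg n, (spin (σ i) - m i) * (spin (σ j) - m j) * ∏ k, p k (σ k) =
        ∏ k, p k (σ k) * ((if k = i then spin (σ k) - m i else 1) *
          (if k = j then spin (σ k) - m j else 1)) := by
      intro σ
      rw [prod_mul_distrib, prod_mul_distrib, prod_ite_eq' univ i (fun k => spin (σ k) - m i),
        prod_ite_eq' univ j (fun k => spin (σ k) - m j)]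
      simp only [mem_univ, if_true]
      ring
    simp only [this]
    rw [← Fintype.prod_sum (fun k b => p k b * ((if k = i then spin b - m i else 1) *
          (if k = j then spin b - m j else 1)))]
    refine prod_eq_zero (mem_univ i) ?_
    simp only [if_true, hij, if_false, mul_one, mul_sub, sum_sub_distrib, ← sum_mul,
      probs_sum hp i, one_mul]
    exact sub_self _
  have hmean : ∀ i, avg (isingW B 0 p) (fun σ => spin (σ i)) = m i := by
    intro i
    unfold avg
    rw [hZ1, div_one, hw]
    have : ∀ σ : Cfg n, spin (σ i) * ∏ k, p k (σ k) =
        ∏ k, p k (σ k) * (if k = i then spin (σ k) else 1) := by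
      intro σ
      rw [prod_mul_distrib, prod_ite_eq' univ i (fun k => spin (σ k))]
      simp only [mem_univ, if_true]
      ring
    simp only [this]
    rw [← Fintype.prod_sum (fun k b => p k b * (if k = i then spin b else 1)),
      prod_eq_single i]
    · simp [hm]
    · intro k _ hk
      simpa [hk] using probs_sum hp k
    · simp
  have hdiag : ∀ i, avg (isingW B 0 p) (fun σ => (spin (σ i) - m i) * (spin (σ i) - m i)) ≤ 1 := by
    intro i
    have h := avg_sub_sq hZ (fun σ : Cfg n => spin (σ i)) (m i)
    simp only [wvar, hmean, spin_sq, avg_const hZ] at h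
    simp only [← sq]
    rw [h]
    nlinarith [sq_nonneg (m i)]
  have h := avg_sub_sq hZ (lin v) (∑ i, v i * m i)
  have hle : wvar (isingW B 0 p) (lin v) ≤
      avg (isingW B 0 p) (fun σ => (lin v σ - ∑ i, v i * m i) ^ 2) := by
    rw [h]; nlinarith [sq_nonneg (avg (isingW B 0 p) (lin v) - ∑ i, v i * m i)]
  refine hle.trans ?_
  have hexp : (fun σ : Cfg n => (lin v σ - ∑ i, v i * m i) ^ 2) = fun σ =>
      ∑ i, ∑ j, (v i * v j) * ((spin (σ i) - m i) * (spin (σ j) - m j)) := by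
    funext σ
    rw [lin, ← sum_sub_distrib, sq, sum_mul_sum]
    exact sum_congr rfl fun i _ => sum_congr rfl fun j _ => by ring
  rw [hexp]
  simp only [avg_sum, avg_const_mul]
  refine sum_le_sum fun i _ => ?_
  rw [sum_eq_single i]
  · nlinarith [hdiag i, sq_nonneg (v i)]
  · intro j _ hj
    rw [hcov i j hj.symm, mul_zero]
  · simp

theorem wvar_lin_smul (w : Cfg n → ℝ) (a : ℝ) (v : Fin n → ℝ) :
    wvar w (lin (a • v)) = a ^ 2 * wvar w (lin v) := by
  have : lin (a • v) = fun σ => a * lin v σ := by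
    funext σ; simp [lin, mul_sum, mul_assoc]
  simp only [wvar, this, mul_pow, avg_const_mul]
  ring

theorem wvar_lin_le_of_unit {w : Cfg n → ℝ} {K : ℝ}
    (h : ∀ v : Fin n → ℝ, ∑ i, v i ^ 2 = 1 → wvar w (lin v) ≤ K) (v : Fin n → ℝ) :
    wvar w (lin v) ≤ K * ∑ i, v i ^ 2 := by
  have h0 : 0 ≤ ∑ i, v i ^ 2 := sum_nonneg fun i _ => sq_nonneg _
  rcases h0.eq_or_lt with h0 | h0
  · have hv : v = (0 : ℝ) • v := by
      have := (sum_eq_zero_iff_of_nonneg (fun i _ => sq_nonneg (v i))).1 h0.symm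
      funext i
      simpa using this i (mem_univ i)
    rw [← h0, hv, wvar_lin_smul]
    simp
  · set r := Real.sqrt (∑ i, v i ^ 2) with hr
    have hr0 : 0 < r := Real.sqrt_pos.2 h0
    have hr2 : r ^ 2 = ∑ i, v i ^ 2 := Real.sq_sqrt h0.le
    have hv : v = r • (r⁻¹ • v) := by rw [smul_smul, mul_inv_cancel₀ hr0.ne', one_smul]
    have hu : ∑ i, (r⁻¹ • v) i ^ 2 = 1 := by
      simp only [Pi.smul_apply, smul_eq_mul, mul_pow, ← mul_sum]
      rw [← hr2]
      field_simp
    rw [hv, wvar_lin_smul, ← hv, hr2, mul_comm]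
    exact mul_le_mul_of_nonneg_right (h _ hu) h0.le

theorem isCompact_unit_sphere (n : ℕ) (r : ℝ) :
    IsCompact {v : Fin n → ℝ | ∑ i, v i ^ 2 = r} := by
  refine Metric.isCompact_of_isClosed_isBounded (isClosed_eq (by fun_prop) continuous_const) ?_
  refine (Metric.isBounded_closedBall (x := (0 : Fin n → ℝ)) (r := Real.sqrt r)).subset ?_
  intro v hv
  rw [mem_closedBall_zero_iff, pi_norm_le_iff_of_nonneg (Real.sqrt_nonneg _)]
  intro i
  rw [Real.norm_eq_abs]
  apply Real.abs_le_sqrt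
  rw [← (show ∑ i, v i ^ 2 = r from hv)]
  exact single_le_sum (f := fun i => v i ^ 2) (fun i _ => sq_nonneg _) (mem_univ i)

theorem deriv_nonneg_of_left_le {f : ℝ → ℝ} {D x : ℝ} (hf : HasDerivAt f D x)
    (h : ∀ᶠ y in nhdsWithin x (Set.Iio x), f y ≤ f x) : 0 ≤ D := by
  have h1 := (hasDerivWithinAt_iff_tendsto_slope' (s := Set.Iio x) (by simp)).1
    hf.hasDerivWithinAt
  refine ge_of_tendsto h1 ?_
  filter_upwards [h, self_mem_nhdsWithin] with y hy hyx
  rw [slope_def_field]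
  exact div_nonneg_of_nonpos (by linarith) (by simpa using le_of_lt hyx)

theorem hasDerivAt_isingW (B : κ → Fin n → ℝ) (p : Fin n → Bool → ℝ) (t : ℝ) (σ : Cfg n) :
    HasDerivAt (fun r => isingW B r p σ)
      (isingW B t p σ * ((1 / 2) * ∑ k, lin (B k) σ ^ 2)) t := by
  have := (((hasDerivAt_id t).mul_const ((1 / 2) * ∑ k, lin (B k) σ ^ 2)).exp).mul_const
    (∏ i, p i (σ i))
  refine this.congr_deriv ?_
  simp only [isingW, id]
  ring

theorem wcov_lin_right (w X : Cfg n → ℝ) (a : Fin n → ℝ) :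
    wcov w X (lin a) = ∑ i, a i * wcov w X (fun σ => spin (σ i)) :=
  wcov_sum_right univ w X a fun i σ => spin (σ i)

theorem sum_wcov_sq_le {w : Cfg n → ℝ} (hw : ∀ σ, 0 ≤ w σ) (hZ : ∑ σ, w σ ≠ 0)
    {B : κ → Fin n → ℝ} {a ψ : ℝ}
    (hB : ∀ c : Fin n → ℝ, ∑ k, (∑ i, B k i * c i) ^ 2 ≤ a * ∑ i, c i ^ 2) (ha : 0 ≤ a)
    (hψ : 0 < ψ) (hle : ∀ v : Fin n → ℝ, wvar w (lin v) ≤ ψ * ∑ i, v i ^ 2) {v : Fin n → ℝ}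
    (hv : wvar w (lin v) = ψ) : ∑ k, wcov w (lin v) (lin (B k)) ^ 2 ≤ a * ψ ^ 2 := by
  obtain ⟨c, hc⟩ : ∃ c : Fin n → ℝ, ∀ i, wcov w (lin v) (fun σ => spin (σ i)) = c i :=
    ⟨_, fun _ => rfl⟩
  have hcov : ∀ b : Fin n → ℝ, wcov w (lin v) (lin b) = ∑ i, b i * c i := by
    intro b
    simp only [wcov_lin_right, hc]
  simp only [hcov]
  refine (hB c).trans (mul_le_mul_of_nonneg_left ?_ ha)
  have h1 := wvar_mul_sub w (lin v) (lin c) ψ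
  have h2 := wvar_nonneg hw hZ (fun σ => ψ * lin v σ - lin c σ)
  have h3 := hle c
  rw [hcov, hv] at h1
  simp only [← sq] at h1
  rw [h1] at h2
  have h4 : 0 ≤ ψ * (ψ ^ 2 - ∑ i, c i ^ 2) := by linear_combination h2 + h3
  linarith [(mul_nonneg_iff_of_pos_left hψ).1 h4]

/-- A spectral condition on the interaction bounds the covariance operator, uniformly in the
product reference measure. -/
theorem wvar_isingW_le (B : κ → Fin n → ℝ)
    (hB : ∀ c : Fin n → ℝ, ∑ k, (∑ i, B k i * c i) ^ 2 ≤ (1 / 10) * ∑ i, c i ^ 2)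
    {p : Fin n → Bool → ℝ} (hp : p ∈ probs n) (v : Fin n → ℝ) :
    wvar (isingW B 1 p) (lin v) ≤ 3 * ∑ i, v i ^ 2 := by
  set K : Set (ℝ × (Fin n → Bool → ℝ) × (Fin n → ℝ)) :=
    Set.Icc 0 1 ×ˢ (probs n ×ˢ {v : Fin n → ℝ | ∑ i, v i ^ 2 = 1}) with hK
  have hKc : IsCompact K := isCompact_Icc.prod
    ((isCompact_univ_pi fun _ => isCompact_stdSimplex ℝ Bool).prod (isCompact_unit_sphere n 1))
  set u : ℝ × (Fin n → Bool → ℝ) × (Fin n → ℝ) → ℝ :=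
    fun x => wvar (isingW B x.1 x.2.1) (lin x.2.2) with hu
  have huc : ContinuousOn (fun x => u x - x.1) K :=
    ((continuousOn_wvar_isingW B).mono fun x hx => hx.2.1).sub continuous_fst.continuousOn
  suffices H : ∀ x ∈ K, u x - x.1 < 2 by
    refine wvar_lin_le_of_unit (fun v hv => ?_) v
    have := H (1, p, v) ⟨by simp, hp, hv⟩
    simp only [hu] at this
    linarith
  by_contra! hne
  set S := K ∩ (fun x => u x - x.1) ⁻¹' Set.Ici 2 with hS
  have hSc : IsCompact S := hKc.of_isClosed_subset
    (huc.preimage_isClosed_of_isClosed hKc.isClosed isClosed_Ici) Set.inter_subset_left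
  have hSn : S.Nonempty := by
    obtain ⟨x, hx, h2⟩ := hne
    exact ⟨x, hx, h2⟩
  obtain ⟨⟨t, q, w⟩, hx, hmin⟩ := hSc.exists_isMinOn hSn continuous_fst.continuousOn
  obtain ⟨⟨ht, hq, hw⟩, hge⟩ := hx
  simp only [Set.mem_preimage, Set.mem_Ici, hu] at hge
  simp only [Set.mem_ofPred_eq] at ht hq hw
  have ht0 : 0 < t := by
    refine lt_of_le_of_ne ht.1 fun h => ?_
    have := wvar_isingW_zero_le B hq w
    rw [← h] at hge
    linarith
  have hlt : ∀ r, 0 ≤ r → r < t → ∀ p ∈ probs n, ∀ v : Fin n → ℝ, ∑ i, v i ^ 2 = 1 →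
      wvar (isingW B r p) (lin v) < 2 + r := by
    intro r hr hrt p hp v hv
    by_contra! hcon
    have hmem : (r, p, v) ∈ S := by
      refine ⟨⟨⟨hr, hrt.le.trans ht.2⟩, hp, hv⟩, ?_⟩
      simp only [Set.mem_preimage, Set.mem_Ici, hu]
      linarith
    have := hmin hmem
    simp only [Set.mem_ofPred_eq] at this
    linarith
  have hleft : ∀ᶠ r in nhdsWithin t (Set.Iio t), 0 ≤ r ∧ r < t := by
    filter_upwards [Ioo_mem_nhdsLT ht0] with r hr
    exact ⟨hr.1.le, hr.2⟩
  have hder := fun (p : Fin n → Bool → ℝ) (hp : p ∈ probs n) (v : Fin n → ℝ) =>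
    hasDerivAt_wvar (fun σ => hasDerivAt_isingW B p t σ) (isingW_sum_pos B t hp).ne' (lin v)
  have hle : ∀ p ∈ probs n, ∀ v : Fin n → ℝ, ∑ i, v i ^ 2 = 1 →
      wvar (isingW B t p) (lin v) ≤ 2 + t := by
    intro p hp v hv
    have hc : Filter.Tendsto (fun r => wvar (isingW B r p) (lin v) - r)
        (nhdsWithin t (Set.Iio t)) (nhds (wvar (isingW B t p) (lin v) - t)) :=
      (((hder p hp v).sub (hasDerivAt_id t)).continuousAt.tendsto).mono_left nhdsWithin_le_nhds
    have := le_of_tendsto hc (b := 2) (by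
      filter_upwards [hleft] with r hr
      linarith [hlt r hr.1 hr.2 p hp v hv])
    linarith
  have heq : wvar (isingW B t q) (lin w) = 2 + t := le_antisymm (hle q hq w hw) (by linarith)
  have hD := deriv_nonneg_of_left_le ((hder q hq w).fun_sub (hasDerivAt_id t)) (by
    filter_upwards [hleft] with r hr
    simp only [id]
    linarith [hlt r hr.1 hr.2 q hq w hw])
  have hmax : ∀ k s, wvar (fun σ => isingW B t q σ * Real.exp (s * lin (B k) σ)) (lin w) ≤
      wvar (isingW B t q) (lin w) := by
    intro k s
    obtain ⟨p', hp', c, hc, he⟩ := isingW_tilt B t hq (B k) s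
    rw [he, wvar_smul hc, heq]
    exact hle p' hp' w hw
  have hL := wvar_deriv_le (isingW_nonneg B t hq) (isingW_sum_pos B t hq) (lin w)
    (fun k => lin (B k)) hmax
  have hC := sum_wcov_sq_le (isingW_nonneg B t hq) (isingW_sum_pos B t hq).ne' hB (by norm_num)
    (by linarith : 0 < 2 + t) (wvar_lin_le_of_unit (hle q hq)) heq
  have h3 : (2 + t) ^ 2 ≤ 3 ^ 2 := by
    have := ht.2
    gcongr
    linarith
  linarith

end product

section quadratic

variable {n : ℕ}

/-- The quadratic form `∑_{i<j} g i j * w i * w j`. -/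
def quadForm (g : Fin n → Fin n → ℝ) (w : Fin n → ℝ) : ℝ :=
  ∑ i, ∑ j, if i < j then g i j * w i * w j else 0

theorem negH_eq (β h : ℝ) (g : Fin n → Fin n → ℝ) (σ : Cfg n) :
    negH n β h g σ =
      β / Real.sqrt n * quadForm g (fun i => spin (σ i)) + h * ∑ i, spin (σ i) := rfl

open scoped MatrixOrder in
theorem exists_symm_sqrt {A : Matrix (Fin n) (Fin n) ℝ} (hA : A.PosSemidef) :
    ∃ S : Matrix (Fin n) (Fin n) ℝ, S * S = A ∧ S.transpose = S := by
  refine ⟨CFC.sqrt A, CFC.sqrt_mul_sqrt_self A hA.nonneg, ?_⟩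
  rw [← Matrix.conjTranspose_eq_transpose_of_trivial]
  exact (Matrix.nonneg_iff_posSemidef.1 (CFC.sqrt_nonneg A)).1

theorem exists_sum_sq_eq (g : Fin n → Fin n → ℝ) {a b : ℝ}
    (hg : ∀ w : Fin n → ℝ, 0 ≤ 2 * b * quadForm g w + a * ∑ i, w i ^ 2) :
    ∃ B : Fin n → Fin n → ℝ, ∀ w : Fin n → ℝ,
      ∑ k, (∑ i, B k i * w i) ^ 2 = 2 * b * quadForm g w + a * ∑ i, w i ^ 2 := by
  set A : Matrix (Fin n) (Fin n) ℝ := Matrix.of fun i j =>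
    b * (if i < j then g i j else 0) + b * (if j < i then g j i else 0) + if i = j then a else 0
    with hA
  have hquad : ∀ w : Fin n → ℝ,
      dotProduct w (A.mulVec w) = 2 * b * quadForm g w + a * ∑ i, w i ^ 2 := by
    intro w
    have h1 : ∀ i j, w i * (A i j * w j) = b * (if i < j then g i j * w i * w j else 0) +
        b * (if j < i then g j i * w j * w i else 0) + if i = j then a * w i ^ 2 else 0 := by
      intro i j
      simp only [hA, Matrix.of_apply]
      by_cases hij : i = j
      · subst hij; simp; ring
      · split_ifs <;> ring
    simp only [dotProduct, Matrix.mulVec, mul_sum, h1, sum_add_distrib, sum_ite_eq, mem_univ,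
      if_true]
    rw [sum_comm (f := fun i j => b * (if j < i then g j i * w j * w i else 0))]
    simp only [← mul_sum, quadForm]
    ring
  have hpsd : A.PosSemidef := by
    refine Matrix.PosSemidef.of_dotProduct_mulVec_nonneg ?_ fun w => ?_
    · ext i j
      simp only [hA, Matrix.of_apply, Matrix.conjTranspose_apply, star_trivial, eq_comm (a := i) (b := j)]
      ring
    · rw [star_trivial, hquad]
      exact hg w
  obtain ⟨S, hS, hST⟩ := exists_symm_sqrt hpsd
  refine ⟨fun k i => S k i, fun w => ?_⟩
  rw [← hquad w, ← hS, ← Matrix.mulVec_mulVec, Matrix.dotProduct_mulVec,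
    ← Matrix.mulVec_transpose, hST]
  simp only [dotProduct, Matrix.mulVec, sq]

theorem wvar_gibbs_le {β h : ℝ} (hβ : 0 < β) (hβ' : β ≤ 1 / 4000) {g : Fin n → Fin n → ℝ}
    (hn : 0 < n)
    (hg : ∀ w : Fin n → ℝ, |quadForm g w| ≤ 80 * Real.sqrt n * ∑ i, w i ^ 2) (v : Fin n → ℝ) :
    wvar (fun σ => Real.exp (negH n β h g σ)) (lin v) ≤ 3 * ∑ i, v i ^ 2 := by
  have hsn : 0 < Real.sqrt n := Real.sqrt_pos.2 (by exact_mod_cast hn)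
  have hb : ∀ w : Fin n → ℝ,
      |2 * (β / Real.sqrt n) * quadForm g w| ≤ (1 / 20) * ∑ i, w i ^ 2 := by
    intro w
    have h0 : 0 ≤ ∑ i, w i ^ 2 := sum_nonneg fun i _ => sq_nonneg _
    rw [abs_mul, abs_of_pos (by positivity)]
    calc 2 * (β / Real.sqrt n) * |quadForm g w|
        ≤ 2 * (β / Real.sqrt n) * (80 * Real.sqrt n * ∑ i, w i ^ 2) := by gcongr; exact hg w
      _ = 160 * β * ∑ i, w i ^ 2 := by field_simp; ring
      _ ≤ (1 / 20) * ∑ i, w i ^ 2 := by gcongr; linarith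
  obtain ⟨B, hB⟩ := exists_sum_sq_eq g (a := 1 / 20) (b := β / Real.sqrt n) (fun w => by
    linarith [(abs_le.1 (hb w)).1])
  set Z := Real.exp (h * 1) + Real.exp (h * -1) with hZ
  have hZ0 : 0 < Z := by positivity
  set p : Fin n → Bool → ℝ := fun _ b => Real.exp (h * spin b) / Z with hp
  have hpm : p ∈ probs n := by
    intro i _
    refine ⟨fun b => by positivity, ?_⟩
    simp only [hp, Fintype.sum_bool, spin, if_true, hZ]
    rw [← add_div]
    exact div_self hZ0.ne'
  have hw : (fun σ => Real.exp (negH n β h g σ)) =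
      fun σ => (Z ^ n * Real.exp (-((1 / 40) * n))) * isingW B 1 p σ := by
    funext σ
    have e1 : ∑ k, lin (B k) σ ^ 2 =
        2 * (β / Real.sqrt n) * quadForm g (fun i => spin (σ i)) + 1 / 20 * n := by
      have := hB (fun i => spin (σ i))
      simp only [spin_sq, sum_const, card_univ, Fintype.card_fin, nsmul_eq_mul, mul_one] at this
      exact this
    have e2 : ∏ i, p i (σ i) = Real.exp (h * ∑ i, spin (σ i)) / Z ^ n := by
      simp only [hp, prod_div_distrib, prod_const, card_univ, Fintype.card_fin, ← Real.exp_sum,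
        mul_sum]
    rw [isingW, e1, e2, negH_eq]
    have e3 : β / Real.sqrt n * quadForm g (fun i => spin (σ i)) + h * ∑ i, spin (σ i) =
        -((1 / 40) * n) + 1 * (1 / 2 * (2 * (β / Real.sqrt n) *
          quadForm g (fun i => spin (σ i)) + 1 / 20 * n)) + h * ∑ i, spin (σ i) := by ring
    rw [e3, Real.exp_add, Real.exp_add]
    field_simp
  rw [hw, wvar_smul (by positivity)]
  refine wvar_isingW_le B (fun c => ?_) hpm v
  rw [hB]
  linarith [(abs_le.1 (hb c)).2]

theorem quadForm_smul (g : Fin n → Fin n → ℝ) (a : ℝ) (w : Fin n → ℝ) :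
    quadForm g (a • w) = a ^ 2 * quadForm g w := by
  simp only [quadForm, mul_sum, Pi.smul_apply, smul_eq_mul]
  refine sum_congr rfl fun i _ => sum_congr rfl fun j _ => ?_
  split_ifs <;> ring

theorem quadForm_sub (g : Fin n → Fin n → ℝ) (x d : Fin n → ℝ) :
    16 * quadForm g (x - d) = 16 * quadForm g x + 16 * quadForm g d
      - quadForm g (x + 8 • d) + quadForm g (x - 8 • d) := by
  simp only [quadForm, mul_sum, ← sum_sub_distrib, ← sum_add_distrib]
  refine sum_congr rfl fun i _ => sum_congr rfl fun j _ => ?_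
  split_ifs
  · simp; ring
  · simp

/-- The integer points used to discretise the sphere. -/
def netPoints (n : ℕ) : Finset (Fin n → ℤ) :=
  {y ∈ Fintype.piFinset fun _ => Icc (-(33 * n : ℤ)) (33 * n) | ∑ i, y i ^ 2 ≤ 33 * n}

theorem exists_netPoint {g : Fin n → Fin n → ℝ} (hn : 0 < n) {K : ℝ} {w : Fin n → ℝ}
    (hw : K * ∑ i, w i ^ 2 < |quadForm g w|) :
    ∃ y ∈ netPoints n, 8 * K * n ≤ |quadForm g (fun i => (y i : ℝ))| := by
  have hn' : (0 : ℝ) < n := by exact_mod_cast hn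
  have hcont : Continuous fun x : Fin n → ℝ => |quadForm g x| := by
    refine Continuous.abs (continuous_finsetSum _ fun i _ => continuous_finsetSum _ fun j _ => ?_)
    split_ifs <;> fun_prop
  have hne : {v : Fin n → ℝ | ∑ i, v i ^ 2 = 16 * n}.Nonempty :=
    ⟨fun _ => 4, by simp; ring⟩
  obtain ⟨x, hx, hxmax⟩ := (isCompact_unit_sphere n (16 * n)).exists_isMaxOn hne hcont.continuousOn
  have hx' : ∑ i, x i ^ 2 = 16 * n := hx
  obtain ⟨m, hm⟩ : ∃ m, |quadForm g x| = m * (16 * n) := ⟨|quadForm g x| / (16 * n), by field_simp⟩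
  have hm0 : 0 ≤ m := by
    by_contra! h
    have := abs_nonneg (quadForm g x)
    nlinarith
  have hall : ∀ z : Fin n → ℝ, |quadForm g z| ≤ m * ∑ i, z i ^ 2 := by
    intro z
    have h0 : 0 ≤ ∑ i, z i ^ 2 := sum_nonneg fun i _ => sq_nonneg _
    rcases h0.eq_or_lt with h0 | h0
    · have hz : z = (0 : ℝ) • z := by
        have := (sum_eq_zero_iff_of_nonneg (fun i _ => sq_nonneg (z i))).1 h0.symm
        funext i
        simpa using this i (mem_univ i)
      rw [← h0, hz, quadForm_smul]
      simp
    · set r := Real.sqrt (16 * n / ∑ i, z i ^ 2) with hr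
      have hr0 : 0 < r := Real.sqrt_pos.2 (by positivity)
      have hr2 : r ^ 2 = 16 * n / ∑ i, z i ^ 2 := Real.sq_sqrt (by positivity)
      have hu : ∑ i, (r • z) i ^ 2 = 16 * n := by
        simp only [Pi.smul_apply, smul_eq_mul, mul_pow, ← mul_sum]
        rw [hr2]
        field_simp
      have h1 : |quadForm g (r • z)| ≤ |quadForm g x| := hxmax hu
      rw [quadForm_smul, abs_mul, abs_of_nonneg (sq_nonneg r), hm, hr2] at h1
      have h2 : (16 * n : ℝ) * |quadForm g z| ≤ (16 * n) * (m * ∑ i, z i ^ 2) := by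
        rw [div_mul_eq_mul_div, div_le_iff₀ h0] at h1
        linarith
      exact le_of_mul_le_mul_left h2 (by positivity)
  have hKm : K ≤ m := by
    by_contra! h
    have h0 : 0 ≤ ∑ i, w i ^ 2 := sum_nonneg fun i _ => sq_nonneg _
    nlinarith [hall w]
  set y : Fin n → ℤ := fun i => round (x i) with hy
  set d : Fin n → ℝ := fun i => x i - y i with hd
  have hyd : (fun i => (y i : ℝ)) = x - d := by funext i; simp [hd]
  have hd2 : ∑ i, d i ^ 2 ≤ n / 4 := by
    calc ∑ i, d i ^ 2 ≤ ∑ _i : Fin n, (1 / 4 : ℝ) := sum_le_sum fun i _ => by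
          have := sq_le_sq' (by linarith [(abs_le.1 (abs_sub_round (x i))).1])
            (abs_le.1 (abs_sub_round (x i))).2
          simp only [hd, hy]
          linarith
      _ = n / 4 := by simp; ring
  refine ⟨y, ?_, ?_⟩
  · have hyR : ∑ i, (y i : ℝ) ^ 2 ≤ 33 * n := by
      calc ∑ i, (y i : ℝ) ^ 2 ≤ ∑ i, (2 * x i ^ 2 + 2 * d i ^ 2) := sum_le_sum fun i _ => by
            have : (y i : ℝ) = x i - d i := congrFun hyd i
            rw [this]
            nlinarith [sq_nonneg (x i + d i)]
        _ = 2 * (16 * n) + 2 * ∑ i, d i ^ 2 := by rw [sum_add_distrib, ← mul_sum, ← mul_sum, hx']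
        _ ≤ 33 * n := by linarith
    have hyZ : ∑ i, y i ^ 2 ≤ 33 * n := by exact_mod_cast hyR
    rw [netPoints, mem_filter, Fintype.mem_piFinset]
    refine ⟨fun i => ?_, hyZ⟩
    have h1 : y i ^ 2 ≤ 33 * n :=
      (single_le_sum (f := fun i => y i ^ 2) (fun i _ => sq_nonneg _) (mem_univ i)).trans hyZ
    rw [mem_Icc]
    constructor
    · nlinarith
    · nlinarith
  · rw [hyd]
    have h1 := quadForm_sub g x d
    have hp := abs_le.1 (hall (x + 8 • d))
    have hq := abs_le.1 (hall (x - 8 • d))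
    have hdd := abs_le.1 (hall d)
    have e : ∑ i, (x + 8 • d) i ^ 2 + ∑ i, (x - 8 • d) i ^ 2 =
        2 * (16 * n) + 128 * ∑ i, d i ^ 2 := by
      rw [← hx', mul_sum, mul_sum, ← sum_add_distrib, ← sum_add_distrib]
      refine sum_congr rfl fun i _ => ?_
      simp
      ring
    have e2 : m * ∑ i, (x + 8 • d) i ^ 2 + m * ∑ i, (x - 8 • d) i ^ 2 =
        m * (2 * (16 * n)) + 128 * (m * ∑ i, d i ^ 2) := by
      rw [← mul_add, e]; ring
    have e3 : m * ∑ i, d i ^ 2 ≤ m * (n / 4) := mul_le_mul_of_nonneg_left hd2 hm0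
    have e4 : K * n ≤ m * n := mul_le_mul_of_nonneg_right hKm hn'.le
    have e5 : 0 ≤ m * n := by positivity
    have e6 : |quadForm g x| ≤ |quadForm g (x - d)| + |quadForm g x - quadForm g (x - d)| := by
      have := abs_add_le (quadForm g (x - d)) (quadForm g x - quadForm g (x - d))
      simpa using this
    have e7 : |quadForm g x - quadForm g (x - d)| ≤ 5 * (m * n) := by
      rw [abs_le]
      constructor <;> linarith
    linarith

end quadratic

section gaussian

variable {n : ℕ}

theorem exp_quadForm (c : ℝ) (g : Fin n → Fin n → ℝ) (y : Fin n → ℝ) :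
    Real.exp (c * quadForm g y) =
      ∏ i, ∏ j, Real.exp ((if i < j then c * (y i * y j) else 0) * g i j) := by
  simp only [← Real.exp_sum, quadForm, mul_sum]
  congr 1
  refine sum_congr rfl fun i _ => sum_congr rfl fun j _ => ?_
  split_ifs <;> ring

theorem integrable_exp_quadForm (c : ℝ) (y : Fin n → ℝ) :
    Integrable (fun g => Real.exp (c * quadForm g y)) (gaussN n) := by
  simp only [exp_quadForm, gaussN]
  refine Integrable.fintype_prod
    (f := fun i (x : Fin n → ℝ) => ∏ j, Real.exp ((if i < j then c * (y i * y j) else 0) * x j))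
    fun i => ?_
  exact Integrable.fintype_prod
    (f := fun j (x : ℝ) => Real.exp ((if i < j then c * (y i * y j) else 0) * x))
    fun j => integrable_exp_mul_gaussianReal _

theorem integral_exp_quadForm_le (c : ℝ) (y : Fin n → ℝ) :
    ∫ g, Real.exp (c * quadForm g y) ∂gaussN n ≤ Real.exp (c ^ 2 / 2 * (∑ i, y i ^ 2) ^ 2) := by
  have hone : ∀ t : ℝ, ∫ x, Real.exp (t * x) ∂gaussianReal 0 1 = Real.exp (t ^ 2 / 2) := by
    intro t
    have := mgf_gaussianReal (p := gaussianReal 0 1) (X := id) (μ := 0) (v := 1) (by simp) t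
    simpa [mgf] using this
  simp only [exp_quadForm, gaussN]
  rw [integral_fintype_prod_eq_prod
    (f := fun i (x : Fin n → ℝ) => ∏ j, Real.exp ((if i < j then c * (y i * y j) else 0) * x j))]
  have : ∀ i, ∫ x : Fin n → ℝ, ∏ j, Real.exp ((if i < j then c * (y i * y j) else 0) * x j)
      ∂(Measure.pi fun _ => gaussianReal 0 1) =
      ∏ j, Real.exp ((if i < j then c * (y i * y j) else 0) ^ 2 / 2) := by
    intro i
    rw [integral_fintype_prod_eq_prod
      (f := fun j (x : ℝ) => Real.exp ((if i < j then c * (y i * y j) else 0) * x))]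
    simp only [hone]
  rw [prod_congr rfl fun i _ => this i]
  simp only [← Real.exp_sum]
  rw [Real.exp_le_exp, sq (∑ i, y i ^ 2), sum_mul_sum, mul_sum]
  refine sum_le_sum fun i _ => ?_
  rw [mul_sum]
  refine sum_le_sum fun j _ => ?_
  split_ifs
  · exact le_of_eq (by ring)
  · have : 0 ≤ c ^ 2 / 2 * (y i ^ 2 * y j ^ 2) := by positivity
    simpa using this

theorem sum_exp_neg_sq_le (m : ℕ) :
    ∑ k ∈ Icc (-(m : ℤ)) m, Real.exp (-(k : ℝ) ^ 2) ≤ 3 := by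
  have hexp : ∀ m : ℕ, Real.exp (-((m + 1 : ℕ) : ℝ) ^ 2) ≤ (1 / 2) ^ (m + 1) := by
    intro m
    calc Real.exp (-((m + 1 : ℕ) : ℝ) ^ 2) ≤ Real.exp (((m + 1 : ℕ) : ℝ) * (-1)) := by
          rw [Real.exp_le_exp]
          push_cast
          nlinarith [(Nat.cast_nonneg m : (0 : ℝ) ≤ m)]
      _ = Real.exp (-1) ^ (m + 1) := by rw [Real.exp_nat_mul]
      _ ≤ (1 / 2) ^ (m + 1) := by
          gcongr
          rw [Real.exp_neg, one_div]
          gcongr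
          linarith [Real.add_one_le_exp (1 : ℝ)]
  have : ∑ k ∈ Icc (-(m : ℤ)) m, Real.exp (-(k : ℝ) ^ 2) ≤ 3 - 2 * (1 / 2) ^ m := by
    induction m with
    | zero => norm_num
    | succ m ih =>
      have hI : Icc (-((m + 1 : ℕ) : ℤ)) ((m + 1 : ℕ) : ℤ) =
          insert ((m + 1 : ℕ) : ℤ) (insert (-((m + 1 : ℕ) : ℤ)) (Icc (-(m : ℤ)) m)) := by
        ext k
        simp only [mem_Icc, mem_insert]
        omega
      rw [hI, sum_insert, sum_insert]
      · have h1 := hexp m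
        have h2 : (1 / 2 : ℝ) ^ (m + 1) = (1 / 2) ^ m / 2 := by rw [pow_succ]; ring
        simp only [Int.cast_neg, Int.cast_natCast, neg_sq]
        linarith
      · simp only [mem_Icc]; omega
      · simp only [mem_Icc, mem_insert]; omega
  have h0 : (0 : ℝ) ≤ (1 / 2) ^ m := by positivity
  linarith

theorem card_netPoints_le (n : ℕ) : (#(netPoints n) : ℝ) ≤ Real.exp (36 * n) := by
  calc (#(netPoints n) : ℝ) = ∑ _y ∈ netPoints n, (1 : ℝ) := by simp
    _ ≤ ∑ y ∈ netPoints n, Real.exp (33 * n) * ∏ i, Real.exp (-(y i : ℝ) ^ 2) := by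
        refine sum_le_sum fun y hy => ?_
        have h := (mem_filter.1 hy).2
        have h' : ∑ i, (y i : ℝ) ^ 2 ≤ 33 * n := by exact_mod_cast h
        rw [← Real.exp_sum, ← Real.exp_add, sum_neg_distrib]
        exact Real.one_le_exp (by linarith)
    _ ≤ ∑ y ∈ Fintype.piFinset fun _ : Fin n => Icc (-(33 * n : ℤ)) (33 * n),
          Real.exp (33 * n) * ∏ i, Real.exp (-(y i : ℝ) ^ 2) :=
        sum_le_sum_of_subset_of_nonneg (filter_subset _ _) fun y _ _ => by positivity
    _ = Real.exp (33 * n) * (∑ k ∈ Icc (-(33 * n : ℤ)) (33 * n), Real.exp (-(k : ℝ) ^ 2)) ^ n := by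
        rw [← mul_sum, sum_prod_piFinset (Icc (-(33 * n : ℤ)) (33 * n))
          (fun _ k => Real.exp (-(k : ℝ) ^ 2))]
        simp
    _ ≤ Real.exp (33 * n) * Real.exp 3 ^ n := by
        have h3 := sum_exp_neg_sq_le (33 * n)
        push_cast at h3
        gcongr
        linarith [Real.add_one_le_exp (3 : ℝ)]
    _ = Real.exp (36 * n) := by
        rw [← Real.exp_nat_mul, ← Real.exp_add]
        congr 1
        ring

/-- An integrable majorant of the event that the disorder has large operator norm. -/
def badMajorant (n : ℕ) (g : Fin n → Fin n → ℝ) : ℝ :=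
  ∑ y ∈ netPoints n, (Real.exp ((Real.sqrt n)⁻¹ * quadForm g (fun i => (y i : ℝ))) +
    Real.exp (-(Real.sqrt n)⁻¹ * quadForm g (fun i => (y i : ℝ)))) * Real.exp (-(640 * n))

theorem badMajorant_nonneg (g : Fin n → Fin n → ℝ) : 0 ≤ badMajorant n g :=
  sum_nonneg fun y _ => by positivity

theorem one_le_badMajorant (hn : 0 < n) {g : Fin n → Fin n → ℝ}
    (hg : ¬ ∀ w : Fin n → ℝ, |quadForm g w| ≤ 80 * Real.sqrt n * ∑ i, w i ^ 2) :
    1 ≤ badMajorant n g := by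
  push Not at hg
  obtain ⟨w, hw⟩ := hg
  obtain ⟨y, hy, hyQ⟩ := exists_netPoint hn hw
  have hn' : (0 : ℝ) < n := by exact_mod_cast hn
  have hsn : 0 < Real.sqrt n := Real.sqrt_pos.2 hn'
  refine le_trans ?_ (single_le_sum (f := fun y : Fin n → ℤ =>
    (Real.exp ((Real.sqrt n)⁻¹ * quadForm g (fun i => (y i : ℝ))) +
    Real.exp (-(Real.sqrt n)⁻¹ * quadForm g (fun i => (y i : ℝ)))) * Real.exp (-(640 * n)))
    (fun y _ => by positivity) hy)
  obtain ⟨Q, hQ⟩ : ∃ Q, quadForm g (fun i => (y i : ℝ)) = Q := ⟨_, rfl⟩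
  simp only [hQ] at hyQ ⊢
  have h1 : 640 * n ≤ (Real.sqrt n)⁻¹ * |Q| := by
    calc (640 : ℝ) * n = (Real.sqrt n)⁻¹ * (8 * (80 * Real.sqrt n) * n) := by field_simp; ring
      _ ≤ (Real.sqrt n)⁻¹ * |Q| := by gcongr
  have h2 : Real.exp ((Real.sqrt n)⁻¹ * |Q|) ≤
      Real.exp ((Real.sqrt n)⁻¹ * Q) + Real.exp (-(Real.sqrt n)⁻¹ * Q) := by
    rcases abs_choice Q with h | h <;> rw [h]
    · linarith [Real.exp_pos (-(Real.sqrt n)⁻¹ * Q)]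
    · rw [mul_neg, ← neg_mul]
      linarith [Real.exp_pos ((Real.sqrt n)⁻¹ * Q)]
  calc (1 : ℝ) = Real.exp (640 * n) * Real.exp (-(640 * n)) := by rw [← Real.exp_add]; simp
    _ ≤ _ := by
        gcongr
        exact (Real.exp_le_exp.2 h1).trans h2

theorem integrable_badMajorant (n : ℕ) : Integrable (badMajorant n) (gaussN n) :=
  integrable_finsetSum _ fun _ _ =>
    ((integrable_exp_quadForm _ _).add (integrable_exp_quadForm _ _)).mul_const _

theorem integral_badMajorant_le (hn : 0 < n) :
    ∫ g, badMajorant n g ∂gaussN n ≤ 2 * Real.exp (-n) := by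
  have hn' : (0 : ℝ) < n := by exact_mod_cast hn
  unfold badMajorant
  have hInt : ∀ y ∈ netPoints n, Integrable (fun g =>
      (Real.exp ((Real.sqrt n)⁻¹ * quadForm g (fun i => (y i : ℝ))) +
        Real.exp (-(Real.sqrt n)⁻¹ * quadForm g (fun i => (y i : ℝ)))) * Real.exp (-(640 * n)))
      (gaussN n) := fun y _ =>
    ((integrable_exp_quadForm _ _).add (integrable_exp_quadForm _ _)).mul_const _
  rw [integral_finsetSum _ hInt]
  calc _ ≤ ∑ y ∈ netPoints n, 2 * Real.exp (545 * n) * Real.exp (-(640 * n)) := by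
        refine sum_le_sum fun y hy => ?_
        rw [integral_mul_const, integral_add (integrable_exp_quadForm _ _)
          (integrable_exp_quadForm _ _)]
        have h := (mem_filter.1 hy).2
        have h' : ∑ i, (y i : ℝ) ^ 2 ≤ 33 * n := by exact_mod_cast h
        have h0 : 0 ≤ ∑ i, (y i : ℝ) ^ 2 := sum_nonneg fun i _ => sq_nonneg _
        have hb : Real.exp (((Real.sqrt n)⁻¹) ^ 2 / 2 * (∑ i, (y i : ℝ) ^ 2) ^ 2) ≤
            Real.exp (545 * n) := by
          rw [Real.exp_le_exp, inv_pow, Real.sq_sqrt hn'.le]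
          calc (n : ℝ)⁻¹ / 2 * (∑ i, (y i : ℝ) ^ 2) ^ 2 ≤ (n : ℝ)⁻¹ / 2 * (33 * (n : ℝ)) ^ 2 := by
                gcongr
            _ = 1089 / 2 * (n : ℝ) := by field_simp; ring
            _ ≤ 545 * (n : ℝ) := by gcongr; norm_num
        have h1 := (integral_exp_quadForm_le (Real.sqrt n)⁻¹ fun i => (y i : ℝ)).trans hb
        have h2 := integral_exp_quadForm_le (-(Real.sqrt n)⁻¹) fun i => (y i : ℝ)
        rw [neg_sq] at h2
        have h3 := h2.trans hb
        gcongr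
        linarith
    _ = #(netPoints n) * (2 * Real.exp (545 * n) * Real.exp (-(640 * n))) := by simp
    _ ≤ Real.exp (36 * n) * (2 * Real.exp (545 * n) * Real.exp (-(640 * n))) := by
        gcongr
        exact card_netPoints_le n
    _ = 2 * Real.exp (36 * n + (545 * n + -(640 * n))) := by
        rw [Real.exp_add, Real.exp_add]; ring
    _ ≤ 2 * Real.exp (-n) := by
        gcongr
        linarith

end gaussian

section replicas

theorem gibbs_eq_avg {n : ℕ} (β h : ℝ) (g : Fin n → Fin n → ℝ) {ι : Type} [DecidableEq ι]
    [Fintype ι] (f : (ι → Cfg n) → ℝ) :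
    gibbs n β h g f = avg (fun σs => ∏ l, Real.exp (negH n β h g (σs l))) f := by
  unfold gibbs avg
  rw [← Fintype.prod_sum fun (_ : ι) σ => Real.exp (negH n β h g σ), prod_const, card_univ]

theorem gibbs_mul_mul {n : ℕ} (β h : ℝ) (g : Fin n → Fin n → ℝ) (a b c : Cfg n → ℝ) :
    gibbs n β h g (fun σs : Fin 3 → Cfg n => a (σs 0) * b (σs 1) * c (σs 2)) =
      avg (fun σ => Real.exp (negH n β h g σ)) a * avg (fun σ => Real.exp (negH n β h g σ)) b *
        avg (fun σ => Real.exp (negH n β h g σ)) c := by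
  have key := Fintype.prod_sum fun (l : Fin 3) σ => ![a, b, c] l σ * Real.exp (negH n β h g σ)
  simp only [prod_mul_distrib] at key
  simp only [Fin.prod_univ_three, Matrix.cons_val] at key
  simp only [gibbs, avg, Fin.prod_univ_three, ← key, Fintype.card_fin]
  rw [pow_three']
  simp only [div_mul_div_comm]

/-- The Gibbs average of `n * (spin (σ¹ k) - spin (σ² k)) * overlap n σ¹ σ³` under the weights `w`. -/
def siteTerm {n : ℕ} (w : Cfg n → ℝ) (k : Fin n) : ℝ :=
  ∑ i, wcov w (fun σ => spin (σ k)) (fun σ => spin (σ i)) * avg w (fun σ => spin (σ i))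

theorem sum_exp_pos {Ω : Type*} [Fintype Ω] [Nonempty Ω] (H : Ω → ℝ) :
    0 < ∑ ω, Real.exp (H ω) := sum_pos (fun _ _ => Real.exp_pos _) univ_nonempty

theorem gibbs_overlap {n : ℕ} (β h q : ℝ) (g : Fin n → Fin n → ℝ) (k : Fin n) :
    gibbs n β h g (fun σs : Fin 3 → Cfg n =>
        (spin (σs 0 k) - spin (σs 1 k)) * (overlap n (σs 0) (σs 2) - q)) =
      (n : ℝ)⁻¹ * siteTerm (fun σ => Real.exp (negH n β h g σ)) k := by
  set w : Cfg n → ℝ := fun σ => Real.exp (negH n β h g σ) with hw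
  have hZ : ∑ σ, w σ ≠ 0 := (sum_exp_pos _).ne'
  have hf : (fun σs : Fin 3 → Cfg n =>
        (spin (σs 0 k) - spin (σs 1 k)) * (overlap n (σs 0) (σs 2) - q)) =
      fun σs => (n : ℝ)⁻¹ * (∑ i, (spin (σs 0 k) * spin (σs 0 i) * 1 * spin (σs 2 i) -
          spin (σs 0 i) * spin (σs 1 k) * spin (σs 2 i))) -
        q * (spin (σs 0 k) * 1 * 1 - 1 * spin (σs 1 k) * 1) := by
    funext σs
    have : ∑ i, (spin (σs 0 k) * spin (σs 0 i) * 1 * spin (σs 2 i) -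
          spin (σs 0 i) * spin (σs 1 k) * spin (σs 2 i)) =
        (spin (σs 0 k) - spin (σs 1 k)) * ∑ i, spin (σs 0 i) * spin (σs 2 i) := by
      rw [mul_sum]
      exact sum_congr rfl fun i _ => by ring
    rw [this, overlap]
    ring
  rw [hf, gibbs_eq_avg]
  simp only [avg_sub, avg_const_mul, avg_sum]
  simp only [← gibbs_eq_avg]
  rw [gibbs_mul_mul β h g (fun σ => spin (σ k)) (fun _ => 1) (fun _ => 1),
    gibbs_mul_mul β h g (fun _ => 1) (fun σ => spin (σ k)) (fun _ => 1)]
  have h1 : ∀ i, gibbs n β h g (fun σs : Fin 3 → Cfg n =>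
      spin (σs 0 k) * spin (σs 0 i) * 1 * spin (σs 2 i)) =
      avg w (fun σ => spin (σ k) * spin (σ i)) * avg w (fun _ => 1) *
        avg w (fun σ => spin (σ i)) := fun i =>
    gibbs_mul_mul β h g (fun σ => spin (σ k) * spin (σ i)) (fun _ => 1) (fun σ => spin (σ i))
  have h2 : ∀ i, gibbs n β h g (fun σs : Fin 3 → Cfg n =>
      spin (σs 0 i) * spin (σs 1 k) * spin (σs 2 i)) =
      avg w (fun σ => spin (σ i)) * avg w (fun σ => spin (σ k)) * avg w (fun σ => spin (σ i)) :=
    fun i => gibbs_mul_mul β h g (fun σ => spin (σ i)) (fun σ => spin (σ k)) (fun σ => spin (σ i))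
  simp only [h1, h2, ← hw, avg_const hZ, siteTerm, wcov]
  rw [show ∀ a q x : ℝ, a - q * (x * 1 * 1 - 1 * x * 1) = a from fun a q x => by ring]
  congr 1
  exact sum_congr rfl fun i _ => by ring

end replicas

section symmetry

variable {n : ℕ}

/-- The action of a permutation of the sites on pairs of sites, keeping the order of each pair. -/
def pairPerm (τ : Equiv.Perm (Fin n)) : Equiv.Perm (Fin n × Fin n) where
  toFun p := if p.1 < p.2 ↔ τ p.1 < τ p.2 then (τ p.1, τ p.2) else (τ p.2, τ p.1)
  invFun p := if p.1 < p.2 ↔ τ.symm p.1 < τ.symm p.2 then (τ.symm p.1, τ.symm p.2)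
    else (τ.symm p.2, τ.symm p.1)
  left_inv p := by
    have := τ.injective.eq_iff (a := p.1) (b := p.2)
    by_cases h : p.1 < p.2 ↔ τ p.1 < τ p.2
    · simp [h]
    · have h' : τ p.2 < τ p.1 ↔ ¬ p.2 < p.1 := by grind
      grind
  right_inv p := by
    have := τ.symm.injective.eq_iff (a := p.1) (b := p.2)
    by_cases h : p.1 < p.2 ↔ τ.symm p.1 < τ.symm p.2
    · simp [h]
    · have h' : τ.symm p.2 < τ.symm p.1 ↔ ¬ p.2 < p.1 := by grind
      grind

/-- The action of a permutation of the sites on the disorder. -/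
def permDisorder (τ : Equiv.Perm (Fin n)) : (Fin n → Fin n → ℝ) ≃ᵐ (Fin n → Fin n → ℝ) :=
  ((MeasurableEquiv.curry (Fin n) (Fin n) ℝ).symm.trans
    (MeasurableEquiv.piCongrLeft (fun _ => ℝ) (pairPerm τ)).symm).trans
    (MeasurableEquiv.curry (Fin n) (Fin n) ℝ)

theorem permDisorder_apply (τ : Equiv.Perm (Fin n)) (g : Fin n → Fin n → ℝ) (i j : Fin n) :
    permDisorder τ g i j = g (pairPerm τ (i, j)).1 (pairPerm τ (i, j)).2 := rfl

theorem measurePreserving_permDisorder (τ : Equiv.Perm (Fin n)) :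
    MeasurePreserving (permDisorder τ) (gaussN n) (gaussN n) := by
  have hc : MeasurePreserving (MeasurableEquiv.curry (Fin n) (Fin n) ℝ)
      (Measure.pi fun _ => gaussianReal 0 1) (gaussN n) := by
    refine ⟨MeasurableEquiv.measurable _, ?_⟩
    have := Measure.infinitePi_map_curry fun (_ _ : Fin n) => gaussianReal 0 1
    simpa only [Measure.infinitePi_eq_pi, gaussN] using this
  have hp := measurePreserving_piCongrLeft (fun _ : Fin n × Fin n => gaussianReal 0 1) (pairPerm τ)
  exact (hc.symm.trans hp.symm).trans hc

theorem negH_permDisorder (β h : ℝ) (τ : Equiv.Perm (Fin n)) (g : Fin n → Fin n → ℝ)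
    (σ : Cfg n) : negH n β h (permDisorder τ g) σ = negH n β h g (σ ∘ τ.symm) := by
  rw [negH_eq, negH_eq]
  congr 2
  · simp only [quadForm, permDisorder_apply]
    rw [← Fintype.sum_prod_type', ← Fintype.sum_prod_type',
      ← Equiv.sum_comp (pairPerm τ) fun p => if p.1 < p.2 then
        g p.1 p.2 * spin ((σ ∘ τ.symm) p.1) * spin ((σ ∘ τ.symm) p.2) else 0]
    refine sum_congr rfl fun p _ => ?_
    have := τ.injective.eq_iff (a := p.1) (b := p.2)
    simp only [pairPerm, Equiv.coe_fn_mk, Function.comp]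
    by_cases h : p.1 < p.2 ↔ τ p.1 < τ p.2
    · simp [h]
    · have h' : τ p.2 < τ p.1 ↔ p.1 < p.2 := by grind
      simp only [h, if_false, h', Equiv.symm_apply_apply]
      split_ifs <;> ring
  · exact (Equiv.sum_comp τ.symm fun i => spin (σ i)).symm

theorem avg_comp_perm (w F : Cfg n → ℝ) (τ : Equiv.Perm (Fin n)) :
    avg (fun σ => w (σ ∘ τ.symm)) F = avg w (fun σ => F (σ ∘ τ)) := by
  unfold avg
  rw [← (Equiv.arrowCongr τ (Equiv.refl Bool)).sum_comp w,
    ← (Equiv.arrowCongr τ (Equiv.refl Bool)).sum_comp fun σ => F (σ ∘ τ) * w σ]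
  congr 1
  refine sum_congr rfl fun σ _ => ?_
  congr 2
  funext i
  simp

theorem siteTerm_permDisorder (β h : ℝ) (τ : Equiv.Perm (Fin n)) (g : Fin n → Fin n → ℝ)
    (k : Fin n) : siteTerm (fun σ => Real.exp (negH n β h (permDisorder τ g) σ)) k =
      siteTerm (fun σ => Real.exp (negH n β h g σ)) (τ k) := by
  simp only [negH_permDisorder, siteTerm, wcov,
    avg_comp_perm (fun σ => Real.exp (negH n β h g σ)) _ τ, Function.comp]
  exact Equiv.sum_comp τ fun i => (avg (fun σ => Real.exp (negH n β h g σ))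
    (fun σ => spin (σ (τ k)) * spin (σ i)) - avg (fun σ => Real.exp (negH n β h g σ))
    (fun σ => spin (σ (τ k))) * avg (fun σ => Real.exp (negH n β h g σ)) (fun σ => spin (σ i))) *
    avg (fun σ => Real.exp (negH n β h g σ)) (fun σ => spin (σ i))

theorem integral_siteTerm_eq (β h : ℝ) (k l : Fin n) :
    ∫ g, siteTerm (fun σ => Real.exp (negH n β h g σ)) k ∂gaussN n =
      ∫ g, siteTerm (fun σ => Real.exp (negH n β h g σ)) l ∂gaussN n := by
  have := (measurePreserving_permDisorder (Equiv.swap k l)).integral_comp'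
    fun g => siteTerm (fun σ => Real.exp (negH n β h g σ)) k
  simp only [siteTerm_permDisorder, Equiv.swap_apply_left] at this
  exact this.symm

theorem integrable_siteTerm_of_integrable (β h : ℝ) (k l : Fin n)
    (hk : Integrable (fun g => siteTerm (fun σ => Real.exp (negH n β h g σ)) k) (gaussN n)) :
    Integrable (fun g => siteTerm (fun σ => Real.exp (negH n β h g σ)) l) (gaussN n) := by
  have := (measurePreserving_permDisorder (Equiv.swap k l)).integrable_comp_of_integrable hk
  simpa only [Function.comp_def, siteTerm_permDisorder, Equiv.swap_apply_left] using this

end symmetry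

section bound

variable {n : ℕ}

theorem abs_avg_spin_le {w : Cfg n → ℝ} (hw : ∀ σ, 0 ≤ w σ) (hZ : ∑ σ, w σ ≠ 0) (i : Fin n) :
    |avg w (fun σ => spin (σ i))| ≤ 1 := by
  have hs : ∀ b, |spin b| ≤ 1 := fun b => by cases b <;> simp [spin]
  rw [abs_le]
  constructor
  · rw [← avg_const hZ (-1)]
    exact avg_mono hw fun σ => (abs_le.1 (hs _)).1
  · rw [← avg_const hZ 1]
    exact avg_mono hw fun σ => (abs_le.1 (hs _)).2

theorem abs_wcov_le {Ω : Type*} [Fintype Ω] {w : Ω → ℝ} (hw : ∀ ω, 0 ≤ w ω)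
    (hZ : ∑ ω, w ω ≠ 0) (X Y : Ω → ℝ) : |wcov w X Y| ≤ (wvar w X + wvar w Y) / 2 := by
  have h1 := wvar_mul_sub w X Y 1
  have h2 := wvar_mul_sub w X Y (-1)
  have h3 := wvar_nonneg hw hZ fun ω => 1 * X ω - Y ω
  have h4 := wvar_nonneg hw hZ fun ω => -1 * X ω - Y ω
  rw [abs_le]
  constructor <;> linarith

theorem wcov_comm {Ω : Type*} [Fintype Ω] (w X Y : Ω → ℝ) : wcov w X Y = wcov w Y X := by
  simp only [wcov, mul_comm]

theorem sum_siteTerm_eq (w : Cfg n → ℝ) :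
    ∑ k, siteTerm w k = wcov w (lin fun _ => 1) (lin fun i => avg w fun σ => spin (σ i)) := by
  have h : ∀ i, wcov w (lin fun _ => 1) (fun σ => spin (σ i)) =
      ∑ k, wcov w (fun σ => spin (σ k)) (fun σ => spin (σ i)) := by
    intro i
    rw [wcov_comm, wcov_lin_right]
    exact sum_congr rfl fun k _ => by rw [one_mul, wcov_comm]
  simp only [siteTerm]
  rw [wcov_lin_right, sum_comm]
  refine sum_congr rfl fun i _ => ?_
  rw [h, mul_comm, sum_mul]

theorem wvar_lin_le_sq {w : Cfg n → ℝ} (hw : ∀ σ, 0 ≤ w σ) (hZ : ∑ σ, w σ ≠ 0)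
    {v : Fin n → ℝ} (hv : ∀ i, |v i| ≤ 1) : wvar w (lin v) ≤ (n : ℝ) ^ 2 := by
  have hl : ∀ σ, lin v σ ^ 2 ≤ (n : ℝ) ^ 2 := by
    intro σ
    rw [sq_le_sq, Nat.abs_cast]
    calc |lin v σ| ≤ ∑ i, |v i * spin (σ i)| := abs_sum_le_sum_abs _ _
      _ ≤ ∑ _i : Fin n, (1 : ℝ) := by
          refine sum_le_sum fun i _ => ?_
          rw [abs_mul]
          have : |spin (σ i)| = 1 := by cases σ i <;> simp [spin]
          rw [this, mul_one]
          exact hv i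
      _ = n := by simp
  have h := avg_mono hw hl
  rw [avg_const hZ] at h
  unfold wvar
  nlinarith [sq_nonneg (avg w (lin v))]

theorem abs_sum_siteTerm_le {β h : ℝ} (hβ : 0 < β) (hβ' : β ≤ 1 / 4000) (hn : 0 < n)
    (g : Fin n → Fin n → ℝ) :
    |∑ k, siteTerm (fun σ => Real.exp (negH n β h g σ)) k| ≤
      3 * n + (n : ℝ) ^ 2 * badMajorant n g := by
  set w : Cfg n → ℝ := fun σ => Real.exp (negH n β h g σ) with hw
  have hw0 : ∀ σ, 0 ≤ w σ := fun σ => (Real.exp_pos _).le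
  have hZ : ∑ σ, w σ ≠ 0 := (sum_exp_pos _).ne'
  have hm := abs_avg_spin_le hw0 hZ
  have hb := badMajorant_nonneg g
  rw [sum_siteTerm_eq]
  refine (abs_wcov_le hw0 hZ _ _).trans ?_
  by_cases hg : ∀ x : Fin n → ℝ, |quadForm g x| ≤ 80 * Real.sqrt n * ∑ i, x i ^ 2
  · have h1 : ∀ v : Fin n → ℝ, (∀ i, |v i| ≤ 1) → wvar w (lin v) ≤ 3 * n := by
      intro v hv
      refine (wvar_gibbs_le hβ hβ' hn hg v).trans ?_
      have : ∑ i, v i ^ 2 ≤ ∑ _i : Fin n, (1 : ℝ) :=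
        sum_le_sum fun i _ => (sq_le_one_iff_abs_le_one _).2 (hv i)
      simp only [sum_const, card_univ, Fintype.card_fin, nsmul_eq_mul, mul_one] at this
      linarith
    have h2 := h1 (fun _ => 1) (by simp)
    have h3 := h1 _ hm
    have : 0 ≤ (n : ℝ) ^ 2 * badMajorant n g := by positivity
    linarith
  · have h1 := one_le_badMajorant hn hg
    have h2 := wvar_lin_le_sq hw0 hZ (v := fun _ => 1) (by simp)
    have h3 := wvar_lin_le_sq hw0 hZ hm
    have h4 : (n : ℝ) ^ 2 * 1 ≤ (n : ℝ) ^ 2 * badMajorant n g := by gcongr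
    have h5 : (0 : ℝ) ≤ n := Nat.cast_nonneg n
    linarith

theorem isProbabilityMeasure_gaussN (n : ℕ) : IsProbabilityMeasure (gaussN n) := by
  unfold gaussN
  infer_instance

theorem abs_integral_siteTerm_le {β h : ℝ} (hβ : 0 < β) (hβ' : β ≤ 1 / 4000) (hn : 0 < n)
    (k : Fin n) :
    |∫ g, siteTerm (fun σ => Real.exp (negH n β h g σ)) k ∂gaussN n| ≤ 5 := by
  have := isProbabilityMeasure_gaussN n
  have hn' : (0 : ℝ) < n := by exact_mod_cast hn
  by_cases hInt : Integrable (fun g => siteTerm (fun σ => Real.exp (negH n β h g σ)) k) (gaussN n)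
  · have hsum : ∫ g, ∑ l, siteTerm (fun σ => Real.exp (negH n β h g σ)) l ∂gaussN n =
        n * ∫ g, siteTerm (fun σ => Real.exp (negH n β h g σ)) k ∂gaussN n := by
      rw [integral_finsetSum _ fun l _ => integrable_siteTerm_of_integrable β h k l hInt,
        sum_congr rfl fun l _ => integral_siteTerm_eq β h l k]
      simp
    have hmaj : Integrable (fun g => 3 * n + (n : ℝ) ^ 2 * badMajorant n g) (gaussN n) :=
      (integrable_const _).add ((integrable_badMajorant n).const_mul _)
    have hle := norm_integral_le_of_norm_le
      (f := fun g => ∑ l, siteTerm (fun σ => Real.exp (negH n β h g σ)) l) hmaj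
      (Filter.Eventually.of_forall fun g => abs_sum_siteTerm_le (h := h) hβ hβ' hn g)
    rw [hsum, Real.norm_eq_abs, abs_mul, Nat.abs_cast,
      integral_add (integrable_const _) ((integrable_badMajorant n).const_mul _),
      integral_const_mul ((n : ℝ) ^ 2), integral_const, probReal_univ, one_smul] at hle
    have hbad := integral_badMajorant_le hn
    have hexp : (n : ℝ) * Real.exp (-n) ≤ 1 := by
      rw [Real.exp_neg, ← div_eq_mul_inv, div_le_one (Real.exp_pos _)]
      linarith [Real.add_one_le_exp (n : ℝ)]
    have h1 : (n : ℝ) ^ 2 * ∫ g, badMajorant n g ∂gaussN n ≤ 2 * n := by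
      calc (n : ℝ) ^ 2 * ∫ g, badMajorant n g ∂gaussN n
          ≤ (n : ℝ) ^ 2 * (2 * Real.exp (-n)) := by gcongr
        _ = 2 * n * (n * Real.exp (-n)) := by ring
        _ ≤ 2 * n * 1 := by gcongr
        _ = 2 * n := mul_one _
    refine le_of_mul_le_mul_left ?_ hn'
    linarith
  · rw [integral_undef hInt]
    norm_num

end bound

/-- at high temperature, `|ν(σ̄₁(R_{1,3} − q))| ≤ L/N` (with `N = M+1`;
`σ̄₁ = σ₁¹ − σ₁²` and three independent replicas). -/
theorem stmt12 :
    ∃ β₀ L : ℝ, 0 < β₀ ∧ 0 < L ∧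
      ∀ β : ℝ, 0 < β → β ≤ β₀ → ∀ h : ℝ, 0 ≤ h → ∀ M : ℕ, ∀ q : ℝ,
        0 ≤ q → q < 1 →
        q = ∫ z, Real.tanh (β * z * Real.sqrt q + h) ^ 2 ∂ (gaussianReal 0 1 : Measure ℝ) →
        |nu (M + 1) β h
            (fun σs : Fin 3 → Cfg (M + 1) =>
              (spin (σs 0 0) - spin (σs 1 0)) * (overlap (M + 1) (σs 0) (σs 2) - q))| ≤
          L / (M + 1) := by
  refine ⟨1 / 4000, 5, by norm_num, by norm_num, ?_⟩
  intro β hβ hβ' h _ M q _ _ _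
  have hb := abs_integral_siteTerm_le (h := h) hβ hβ' M.succ_pos 0
  have hM : (0 : ℝ) < M + 1 := by positivity
  simp only [nu, gibbs_overlap]
  rw [integral_const_mul, abs_mul, abs_inv, Nat.abs_cast, div_eq_inv_mul]
  push_cast
  gcongr

end
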